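/- arXiv:1410.0917 — 2 statements merged into one kernel-verified Lean document; each statement's English description precedes it below -/
import Mathlib

section
/- For every real number x > 0, |J₀(x)| ≤ 0.7858 · x^{−1/3}. -/
open Real Complex

/-- Bessel function of the first kind with integer order `n`, defined by the
integral `J_n(x) = (1/(2π)) ∫₀^{2π} exp(i (x sin φ − n φ)) dφ`
(the integral is real-valued; we take the real-valued cosine form). -/
noncomputable def besselJ (n : ℤ) (x : ℝ) : ℝ :=
  (1 / (2 * Real.pi)) * ∫ φ in (0:ℝ)..(2 * Real.pi), Real.cos (x * Real.sin φ - n * φ)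

/-- A function vanishing at `0` with nonnegative derivative on `[0, ∞)` is nonnegative there. -/
lemma nonneg_of_hasDerivAt_nonneg {f f' : ℝ → ℝ} (hf : ∀ x, HasDerivAt f (f' x) x)
    (h0 : f 0 = 0) (hf' : ∀ x, 0 ≤ x → 0 ≤ f' x) {x : ℝ} (hx : 0 ≤ x) : 0 ≤ f x := by
  have hmono : MonotoneOn f (Set.Ici 0) := by
    refine monotoneOn_of_hasDerivWithinAt_nonneg (convex_Ici 0)
      (fun y _ => (hf y).continuousAt.continuousWithinAt)
      (fun y _ => (hf y).hasDerivWithinAt) fun y hy => hf' y ?_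
    rw [interior_Ici] at hy
    exact le_of_lt hy
  simpa [h0] using hmono Set.self_mem_Ici hx hx

/-- The derivative of `besselJ 0`, in integral form. -/
noncomputable def besselJZeroDeriv (x : ℝ) : ℝ :=
  (1 / (2 * π)) * ∫ φ in (0:ℝ)..(2 * π), -(Real.sin φ * Real.sin (x * Real.sin φ))

/-- The second derivative of `besselJ 0`, in integral form. -/
noncomputable def besselJZeroDerivTwo (x : ℝ) : ℝ :=
  (1 / (2 * π)) * ∫ φ in (0:ℝ)..(2 * π), -(Real.sin φ ^ 2 * Real.cos (x * Real.sin φ))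

lemma besselJ_zero_eq (x : ℝ) :
    besselJ 0 x = (1 / (2 * π)) * ∫ φ in (0:ℝ)..(2 * π), Real.cos (x * Real.sin φ) := by
  simp [besselJ]

/-- Differentiation under the integral sign for a jointly continuous bounded derivative. -/
lemma hasDerivAt_intervalIntegral_of_bounded {F F' : ℝ → ℝ → ℝ} {a b C : ℝ}
    (hF : ∀ x, Continuous (F x)) (hF' : ∀ x, Continuous (F' x))
    (hbound : ∀ x t, |F' x t| ≤ C) (hderiv : ∀ x t, HasDerivAt (fun y => F y t) (F' x t) x)
    (x : ℝ) : HasDerivAt (fun y => ∫ t in a..b, F y t) (∫ t in a..b, F' x t) x :=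
  (intervalIntegral.hasDerivAt_integral_of_dominated_loc_of_deriv_le
    (s := Set.univ) (bound := fun _ => C) Filter.univ_mem
    (Filter.Eventually.of_forall fun y => (hF y).aestronglyMeasurable)
    ((hF x).intervalIntegrable _ _) (hF' x).aestronglyMeasurable
    (Filter.Eventually.of_forall fun t _ y _ => hbound y t)
    intervalIntegrable_const
    (Filter.Eventually.of_forall fun t _ y _ => hderiv y t)).2

lemma hasDerivAt_besselJ_zero (x : ℝ) : HasDerivAt (besselJ 0) (besselJZeroDeriv x) x := by
  rw [funext besselJ_zero_eq]
  refine (hasDerivAt_intervalIntegral_of_bounded (C := 1)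
    (F := fun y t => Real.cos (y * Real.sin t))
    (F' := fun y t => -(Real.sin t * Real.sin (y * Real.sin t))) (fun y => by fun_prop)
    (fun y => by fun_prop) (fun y t => ?_) (fun y t => ?_) x).const_mul _
  · rw [abs_neg, abs_mul]
    exact mul_le_one₀ (abs_sin_le_one _) (abs_nonneg _) (abs_sin_le_one _)
  · refine ((hasDerivAt_id y).mul_const (Real.sin t)).cos.congr_deriv ?_
    simp only [id]; ring

lemma hasDerivAt_besselJZeroDeriv (x : ℝ) :
    HasDerivAt besselJZeroDeriv (besselJZeroDerivTwo x) x := by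
  refine (hasDerivAt_intervalIntegral_of_bounded (C := 1)
    (F := fun y t => -(Real.sin t * Real.sin (y * Real.sin t)))
    (F' := fun y t => -(Real.sin t ^ 2 * Real.cos (y * Real.sin t))) (fun y => by fun_prop)
    (fun y => by fun_prop) (fun y t => ?_) (fun y t => ?_) x).const_mul _
  · rw [abs_neg, abs_mul, abs_pow]
    exact mul_le_one₀ (pow_le_one₀ (abs_nonneg _) (abs_sin_le_one _)) (abs_nonneg _)
      (abs_cos_le_one _)
  · refine ((((hasDerivAt_id y).mul_const (Real.sin t)).sin).const_mul
      (Real.sin t)).neg.congr_deriv ?_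
    simp only [id]; ring

/-- Bessel's differential equation of order zero. -/
lemma besselJ_zero_ode (x : ℝ) :
    x * besselJZeroDerivTwo x + besselJZeroDeriv x + x * besselJ 0 x = 0 := by
  have hd : ∀ t ∈ Set.uIcc 0 (2 * π), HasDerivAt
      (fun s => Real.cos s * Real.sin (x * Real.sin s))
      (x * -(Real.sin t ^ 2 * Real.cos (x * Real.sin t)) +
        -(Real.sin t * Real.sin (x * Real.sin t)) + x * Real.cos (x * Real.sin t)) t := by
    intro t _
    refine ((Real.hasDerivAt_cos t).mul
      (((Real.hasDerivAt_sin t).const_mul x).sin)).congr_deriv ?_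
    linear_combination (x * Real.cos (x * Real.sin t)) * Real.sin_sq_add_cos_sq t
  have hi := intervalIntegral.integral_eq_sub_of_hasDerivAt hd
    (Continuous.intervalIntegrable (by fun_prop) _ _)
  rw [intervalIntegral.integral_add (Continuous.intervalIntegrable (by fun_prop) _ _)
      (Continuous.intervalIntegrable (by fun_prop) _ _),
    intervalIntegral.integral_add (Continuous.intervalIntegrable (by fun_prop) _ _)
      (Continuous.intervalIntegrable (by fun_prop) _ _),
    intervalIntegral.integral_const_mul, intervalIntegral.integral_const_mul] at hi
  simp only [Real.sin_two_pi, Real.sin_zero, mul_zero, sub_zero] at hi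
  rw [besselJ_zero_eq, besselJZeroDeriv, besselJZeroDerivTwo]
  linear_combination (1 / (2 * π)) * hi

lemma besselJ_zero_zero : besselJ 0 0 = 1 := by
  rw [besselJ_zero_eq]
  simp
  field_simp

lemma besselJZeroDeriv_zero : besselJZeroDeriv 0 = 0 := by
  simp [besselJZeroDeriv]

lemma besselJ_zero_le_one (x : ℝ) : besselJ 0 x ≤ 1 := by
  rw [besselJ_zero_eq]
  have h := intervalIntegral.integral_mono_on (a := 0) (b := 2 * π) (by positivity)
    (Continuous.intervalIntegrable (by fun_prop : Continuous fun φ => Real.cos (x * Real.sin φ))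
      _ _) (intervalIntegrable_const (μ := MeasureTheory.volume) (c := (1 : ℝ)))
      fun φ _ => Real.cos_le_one _
  rw [intervalIntegral.integral_const, smul_eq_mul, mul_one, sub_zero] at h
  rw [one_div_mul_eq_div]
  exact div_le_one_of_le₀ h (by positivity)

/-- Integrating Bessel's equation twice: a one-sided bound (with sign `ε`) of `besselJ 0` by `p`
yields opposite bounds of the derivative by `q` and of `besselJ 0` by `r`, where
`(t q)' = - t p` and `r' = q`. -/
lemma besselJ_zero_bound_step {p q r : ℝ → ℝ} (ε : ℝ)
    (hp : ∀ x, 0 ≤ x → 0 ≤ ε * (p x - besselJ 0 x))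
    (hq : ∀ x, HasDerivAt (fun t => t * q t) (-(x * p x)) x) (hq0 : q 0 = 0)
    (hr : ∀ x, HasDerivAt r (q x) x) (hr0 : r 0 = 1) :
    (∀ x, 0 ≤ x → 0 ≤ ε * (besselJZeroDeriv x - q x)) ∧
      ∀ x, 0 ≤ x → 0 ≤ ε * (besselJ 0 x - r x) := by
  have hderiv : ∀ x, 0 ≤ x → 0 ≤ ε * (besselJZeroDeriv x - q x) := by
    intro x hx
    have h : 0 ≤ ε * (x * besselJZeroDeriv x - x * q x) := by
      refine nonneg_of_hasDerivAt_nonneg (f' := fun y => y * (ε * (p y - besselJ 0 y)))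
        (f := fun y => ε * (y * besselJZeroDeriv y - y * q y)) (fun y => ?_) (by simp)
        (fun y hy => mul_nonneg hy (hp y hy)) hx
      refine ((((hasDerivAt_id y).mul (hasDerivAt_besselJZeroDeriv y)).sub
        (hq y)).const_mul ε).congr_deriv ?_
      simp only [id]
      linear_combination ε * besselJ_zero_ode y
    rcases hx.eq_or_lt with rfl | hx
    · simp [besselJZeroDeriv_zero, hq0]
    · refine nonneg_of_mul_nonneg_right (a := x) ?_ hx
      linarith
  refine ⟨hderiv, fun x hx => ?_⟩
  exact nonneg_of_hasDerivAt_nonneg (f := fun y => ε * (besselJ 0 y - r y))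
    (fun y => ((hasDerivAt_besselJ_zero y).sub (hr y)).const_mul ε)
    (by simp [besselJ_zero_zero, hr0]) hderiv hx

/-- Alternating Taylor bounds for `besselJ 0` and its derivative. -/
lemma besselJ_zero_taylor_bounds {x : ℝ} (hx : 0 ≤ x) :
    1 - x ^ 2 / 4 + x ^ 4 / 64 - x ^ 6 / 2304 ≤ besselJ 0 x ∧
    besselJ 0 x ≤ 1 - x ^ 2 / 4 + x ^ 4 / 64 - x ^ 6 / 2304 + x ^ 8 / 147456 ∧
    -(x / 2) + x ^ 3 / 16 - x ^ 5 / 384 ≤ besselJZeroDeriv x ∧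
    besselJZeroDeriv x ≤ -(x / 2) + x ^ 3 / 16 - x ^ 5 / 384 + x ^ 7 / 18432 := by
  have hpow (n : ℕ) (y : ℝ) := hasDerivAt_pow n y
  obtain ⟨-, h1⟩ := besselJ_zero_bound_step (p := fun _ => 1) (q := fun t => -(t / 2))
    (r := fun t => 1 - t ^ 2 / 4) 1
    (fun y _ => by linarith [besselJ_zero_le_one y])
    (fun y => ((hasDerivAt_id y).mul ((hasDerivAt_id y).div_const 2).neg).congr_deriv
      (by simp; ring)) (by simp)
    (fun y => (((hpow 2 y).div_const 4).const_sub 1).congr_deriv (by norm_num; ring)) (by simp)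
  obtain ⟨-, h2⟩ := besselJ_zero_bound_step (p := fun t => 1 - t ^ 2 / 4)
    (q := fun t => -(t / 2) + t ^ 3 / 16)
    (r := fun t => 1 - t ^ 2 / 4 + t ^ 4 / 64) (-1)
    (fun y hy => by linarith [h1 y hy])
    (fun y => ((hasDerivAt_id y).mul (((hasDerivAt_id y).div_const 2).neg.add
      ((hpow 3 y).div_const 16))).congr_deriv (by simp; ring)) (by simp)
    (fun y => ((((hpow 2 y).div_const 4).const_sub 1).add
      ((hpow 4 y).div_const 64)).congr_deriv (by norm_num; ring)) (by simp)
  obtain ⟨h3', h3⟩ := besselJ_zero_bound_step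
    (p := fun t => 1 - t ^ 2 / 4 + t ^ 4 / 64)
    (q := fun t => -(t / 2) + t ^ 3 / 16 - t ^ 5 / 384)
    (r := fun t => 1 - t ^ 2 / 4 + t ^ 4 / 64 - t ^ 6 / 2304) 1
    (fun y hy => by linarith [h2 y hy])
    (fun y => ((hasDerivAt_id y).mul ((((hasDerivAt_id y).div_const 2).neg.add
      ((hpow 3 y).div_const 16)).sub ((hpow 5 y).div_const 384))).congr_deriv
      (by simp; ring)) (by simp)
    (fun y => (((((hpow 2 y).div_const 4).const_sub 1).add
      ((hpow 4 y).div_const 64)).sub ((hpow 6 y).div_const 2304)).congr_deriv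
      (by norm_num; ring)) (by simp)
  obtain ⟨h4', h4⟩ := besselJ_zero_bound_step
    (p := fun t => 1 - t ^ 2 / 4 + t ^ 4 / 64 - t ^ 6 / 2304)
    (q := fun t => -(t / 2) + t ^ 3 / 16 - t ^ 5 / 384 + t ^ 7 / 18432)
    (r := fun t => 1 - t ^ 2 / 4 + t ^ 4 / 64 - t ^ 6 / 2304 + t ^ 8 / 147456) (-1)
    (fun y hy => by linarith [h3 y hy])
    (fun y => ((hasDerivAt_id y).mul (((((hasDerivAt_id y).div_const 2).neg.add
      ((hpow 3 y).div_const 16)).sub ((hpow 5 y).div_const 384)).add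
      ((hpow 7 y).div_const 18432))).congr_deriv (by simp; ring)) (by simp)
    (fun y => ((((((hpow 2 y).div_const 4).const_sub 1).add
      ((hpow 4 y).div_const 64)).sub ((hpow 6 y).div_const 2304)).add
      ((hpow 8 y).div_const 147456)).congr_deriv (by norm_num; ring)) (by simp)
  exact ⟨by linarith [h3 x hx], by linarith [h4 x hx], by linarith [h3' x hx],
    by linarith [h4' x hx]⟩

/-- The Sonin-type energy `u'² + (1 + 1/(4x²)) u²` of `u = √x J₀(x)`. -/
noncomputable def besselJZeroEnergy (x : ℝ) : ℝ :=
  x * besselJZeroDeriv x ^ 2 + besselJ 0 x * besselJZeroDeriv x + besselJ 0 x ^ 2 / (2 * x) +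
    x * besselJ 0 x ^ 2

lemma hasDerivAt_besselJZeroEnergy {x : ℝ} (hx : 0 < x) :
    HasDerivAt besselJZeroEnergy (-(besselJ 0 x ^ 2 / (2 * x ^ 2))) x := by
  have hJ := hasDerivAt_besselJ_zero x
  have hJ' := hasDerivAt_besselJZeroDeriv x
  have hid := hasDerivAt_id x
  refine (((hid.mul (hJ'.pow 2)).add (hJ.mul hJ')).add
    ((hJ.pow 2).div (hid.const_mul 2) (by simpa using hx.ne'))).add
    (hid.mul (hJ.pow 2)) |>.congr_deriv ?_
  have hode : besselJZeroDerivTwo x = -besselJ 0 x - besselJZeroDeriv x / x := by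
    field_simp
    linear_combination besselJ_zero_ode x
  simp only [id, hode, Pi.pow_apply]
  field_simp
  ring

lemma besselJZeroEnergy_antitoneOn : AntitoneOn besselJZeroEnergy (Set.Ioi 0) := by
  refine antitoneOn_of_hasDerivWithinAt_nonpos (convex_Ioi 0)
    (fun y hy => (hasDerivAt_besselJZeroEnergy hy).continuousAt.continuousWithinAt)
    (fun y hy => (hasDerivAt_besselJZeroEnergy (interior_subset hy)).hasDerivWithinAt)
    fun y _ => neg_nonpos.mpr (by positivity)

lemma mul_besselJ_zero_sq_le_energy {x : ℝ} (hx : 0 < x) :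
    x * besselJ 0 x ^ 2 ≤ besselJZeroEnergy x := by
  have h : besselJZeroEnergy x - x * besselJ 0 x ^ 2 =
      ((2 * x * besselJZeroDeriv x + besselJ 0 x) ^ 2 + besselJ 0 x ^ 2) / (4 * x) := by
    rw [besselJZeroEnergy]
    field_simp
    ring
  have : 0 ≤ besselJZeroEnergy x - x * besselJ 0 x ^ 2 := by
    rw [h]
    positivity
  linarith

lemma besselJZeroEnergy_three_halves_le : besselJZeroEnergy (3 / 2) ≤ 0.7 := by
  obtain ⟨h1, h2, h3, h4⟩ := besselJ_zero_taylor_bounds (x := 3 / 2) (by norm_num)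
  rw [besselJZeroEnergy]
  norm_num at h1 h2 h3 h4 ⊢
  set J := besselJ 0 (3 / 2)
  set D := besselJZeroDeriv (3 / 2)
  have hJ1 : 0.51 ≤ J := by linarith
  have hJ2 : J ≤ 0.513 := by linarith
  have hD1 : -0.56 ≤ D := by linarith
  have hD2 : D ≤ -0.55 := by linarith
  nlinarith [mul_nonneg (sub_nonneg.2 hJ1) (sub_nonneg.2 hJ2),
    mul_nonneg (sub_nonneg.2 hD1) (sub_nonneg.2 hD2),
    mul_nonneg (sub_nonneg.2 hJ1) (sub_nonneg.2 hD2)]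

/-- The bound in terms of the cube root `y` of the argument, for small arguments. -/
lemma mul_besselJ_zero_cube_le_of_le {y : ℝ} (hy : 0 < y) (h : y ^ 3 ≤ 3 / 2) :
    y * |besselJ 0 (y ^ 3)| ≤ 0.7858 := by
  obtain ⟨x, hx⟩ : ∃ x, x = y ^ 3 := ⟨_, rfl⟩
  have hx0 : 0 < x := hx ▸ pow_pos hy 3
  rw [← hx] at h ⊢
  obtain ⟨hl, hu, -, -⟩ := besselJ_zero_taylor_bounds hx0.le
  have hsq : x ^ 2 ≤ 9 / 4 := by nlinarith
  have hJ : 0 ≤ besselJ 0 x := by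
    have h6 : x ^ 6 ≤ x ^ 4 * (9 / 4) := by
      nlinarith [mul_le_mul_of_nonneg_left hsq (pow_nonneg hx0.le 4)]
    nlinarith [pow_nonneg hx0.le 4]
  rw [abs_of_nonneg hJ]
  have hy' : y ≤ 625 / 1587 * x + 46 / 75 := by
    rw [hx]
    linarith [mul_nonneg (add_nonneg hy.le (by norm_num : (0 : ℝ) ≤ 46 / 25))
      (sq_nonneg (y - 23 / 25))]
  have hu' : besselJ 0 x ≤ 1 - x ^ 2 / 4 + x ^ 4 / 64 - x ^ 6 / 2400 := by
    have h8 : x ^ 8 ≤ x ^ 6 * (9 / 4) := by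
      nlinarith [mul_le_mul_of_nonneg_left hsq (pow_nonneg hx0.le 6)]
    nlinarith [pow_nonneg hx0.le 6]
  refine (mul_le_mul hy' hu' hJ (by positivity)).trans ?_
  have hx2 : 0 ≤ 3 / 2 - x := by linarith
  have hD : 0 ≤ (x - 393 / 500) ^ 2 := sq_nonneg _
  linarith [sq_nonneg (x - 157 / 200), sq_nonneg (x - 787 / 1000), hD, mul_nonneg hD hx0.le,
    mul_nonneg hD (mul_nonneg hx0.le hx2), mul_nonneg hD (mul_nonneg (pow_nonneg hx0.le 2) hx2),
    mul_nonneg hD (pow_nonneg hx0.le 4), mul_nonneg hD (pow_nonneg hx0.le 5)]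

/-- The bound in terms of the cube root `y` of the argument, for large arguments. -/
lemma mul_besselJ_zero_cube_le_of_ge {y : ℝ} (hy : 0 < y) (h : 3 / 2 ≤ y ^ 3) :
    y * |besselJ 0 (y ^ 3)| ≤ 0.7858 := by
  have hx : 0 < y ^ 3 := pow_pos hy 3
  have hE := (mul_besselJ_zero_sq_le_energy hx).trans
    ((besselJZeroEnergy_antitoneOn (by norm_num) hx h).trans besselJZeroEnergy_three_halves_le)
  have hy1 : 1.14 ≤ y := by
    by_contra! hlt
    have := pow_lt_pow_left₀ hlt hy.le three_ne_zero
    norm_num at this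
    linarith
  refine abs_le_of_sq_le_sq' ?_ (by norm_num) |>.2
  rw [mul_pow, sq_abs]
  nlinarith [mul_nonneg (sub_nonneg.2 hy1) (mul_nonneg (sq_nonneg y)
    (sq_nonneg (besselJ 0 (y ^ 3))))]

/-- Landau's uniform bound on `J₀` (Property (B4) of the paper). -/
theorem stmt5 (x : ℝ) (hx : 0 < x) :
    |besselJ 0 x| ≤ 0.7858 * x ^ (-(1/3) : ℝ) := by
  obtain ⟨y, hy⟩ : ∃ y, y = x ^ (1 / 3 : ℝ) := ⟨_, rfl⟩
  have hy0 : 0 < y := hy ▸ Real.rpow_pos_of_pos hx _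
  have hyx : y ^ 3 = x := by
    rw [hy, ← Real.rpow_natCast, ← Real.rpow_mul hx.le]
    norm_num
  rw [Real.rpow_neg hx.le, ← hy, ← div_eq_mul_inv, le_div_iff₀' hy0, ← hyx]
  rcases le_total (y ^ 3) (3 / 2) with h | h
  · exact mul_besselJ_zero_cube_le_of_le hy0 h
  · exact mul_besselJ_zero_cube_le_of_ge hy0 h
end

section
/- For every real number x and every t ∈ [−1, 1], the family indexed by ℓ ∈ ℕ given by ℓ ↦ ((2ℓ+1)/2)·(∫_{−1}^{1} exp(i·x·τ)·P_ℓ(τ) dτ)·P_ℓ(t) is summable with sum exp(i·x·t). -/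
open Real Complex

/-- The Legendre polynomial `P_ℓ`, defined by Rodrigues' formula. -/
noncomputable def legendreP (ℓ : ℕ) : Polynomial ℝ :=
  (1 / (2 ^ ℓ * (Nat.factorial ℓ)) : ℝ) •
    (Polynomial.derivative^[ℓ] ((Polynomial.X ^ 2 - 1) ^ ℓ))

open Polynomial in
/-- Integration by parts for polynomials on `[-1, 1]`, with vanishing boundary terms. -/
theorem integral_eval_derivative_mul (p q : ℝ[X]) (h₁ : p.eval 1 = 0) (h₂ : p.eval (-1) = 0) :
    ∫ τ in (-1 : ℝ)..1, (derivative p * q).eval τ =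
      -∫ τ in (-1 : ℝ)..1, (p * derivative q).eval τ := by
  have h := intervalIntegral.integral_eq_sub_of_hasDerivAt (a := -1) (b := 1)
    (fun x _ => (p * q).hasDerivAt x) ((derivative (p * q)).continuous.intervalIntegrable _ _)
  simp only [derivative_mul, eval_add, eval_mul, h₁, h₂, zero_mul, sub_zero] at h
  rw [intervalIntegral.integral_add (Continuous.intervalIntegrable (by fun_prop) _ _)
    (Continuous.intervalIntegrable (by fun_prop) _ _)] at h
  simp only [eval_mul]
  linarith

open Polynomial in
theorem integral_eval_iterate_derivative_mul (p q : ℝ[X]) (k : ℕ)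
    (h₁ : ∀ j < k, (derivative^[j] p).eval 1 = 0)
    (h₂ : ∀ j < k, (derivative^[j] p).eval (-1) = 0) :
    ∫ τ in (-1 : ℝ)..1, (derivative^[k] p * q).eval τ =
      (-1) ^ k * ∫ τ in (-1 : ℝ)..1, (p * derivative^[k] q).eval τ := by
  induction k generalizing q with
  | zero => simp
  | succ k ih =>
    rw [Function.iterate_succ_apply',
      integral_eval_derivative_mul _ _ (h₁ k k.lt_succ_self) (h₂ k k.lt_succ_self),
      ih _ (fun j hj => h₁ j (hj.trans k.lt_succ_self)) (fun j hj => h₂ j (hj.trans k.lt_succ_self)),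
      ← Function.iterate_succ_apply, pow_succ]
    ring

open Polynomial in
theorem eval_iterate_derivative_X_sq_sub_one_pow {ℓ j : ℕ} (hj : j < ℓ) {s : ℝ} (hs : s ^ 2 = 1) :
    (derivative^[j] ((X ^ 2 - 1 : ℝ[X]) ^ ℓ)).eval s = 0 := by
  obtain ⟨r, hr⟩ := pow_sub_dvd_iterate_derivative_pow (X ^ 2 - 1 : ℝ[X]) ℓ j
  rw [hr]
  simp [hs, Nat.sub_ne_zero_of_lt hj]

open Polynomial in
/-- Rodrigues' formula integrated against a polynomial. -/
theorem integral_eval_mul_legendreP (q : ℝ[X]) (ℓ : ℕ) :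
    ∫ τ in (-1 : ℝ)..1, q.eval τ * (legendreP ℓ).eval τ =
      1 / (2 ^ ℓ * ℓ.factorial) *
        ∫ τ in (-1 : ℝ)..1, (1 - τ ^ 2) ^ ℓ * (derivative^[ℓ] q).eval τ := by
  have h := integral_eval_iterate_derivative_mul ((X ^ 2 - 1 : ℝ[X]) ^ ℓ) q ℓ
    (fun j hj => eval_iterate_derivative_X_sq_sub_one_pow hj (by norm_num))
    (fun j hj => eval_iterate_derivative_X_sq_sub_one_pow hj (by norm_num))
  rw [← intervalIntegral.integral_const_mul] at h
  have e : ∀ τ : ℝ, q.eval τ * (legendreP ℓ).eval τ = 1 / (2 ^ ℓ * ℓ.factorial) *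
      (derivative^[ℓ] ((X ^ 2 - 1 : ℝ[X]) ^ ℓ) * q).eval τ := fun τ => by
    simp only [legendreP, eval_smul, eval_mul, smul_eq_mul]
    ring
  simp only [e]
  rw [intervalIntegral.integral_const_mul, h]
  congr 2
  ext τ
  simp only [eval_mul, eval_pow, eval_sub, eval_X, eval_one]
  rw [← mul_assoc, ← mul_pow]
  ring

open Polynomial in
theorem X_sq_sub_one_pow_monic (ℓ : ℕ) : ((X ^ 2 - 1 : ℝ[X]) ^ ℓ).Monic :=
  (monic_X_pow_sub_C (1 : ℝ) two_ne_zero).pow ℓ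

open Polynomial in
theorem natDegree_X_sq_sub_one_pow (ℓ : ℕ) : ((X ^ 2 - 1 : ℝ[X]) ^ ℓ).natDegree = ℓ + ℓ := by
  have h := natDegree_X_pow_sub_C (n := 2) (r := (1 : ℝ))
  rw [C_1] at h
  rw [natDegree_pow, h]
  ring

open Polynomial in
theorem iterate_derivative_legendreP (ℓ : ℕ) :
    derivative^[ℓ] (legendreP ℓ) = C (((2 * ℓ).factorial : ℝ) / (2 ^ ℓ * ℓ.factorial)) := by
  rw [legendreP, iterate_derivative_smul, ← Function.iterate_add_apply]
  have h : (derivative^[ℓ + ℓ] ((X ^ 2 - 1 : ℝ[X]) ^ ℓ)).natDegree = 0 := by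
    have := natDegree_iterate_derivative ((X ^ 2 - 1 : ℝ[X]) ^ ℓ) (ℓ + ℓ)
    rw [natDegree_X_sq_sub_one_pow] at this
    omega
  rw [eq_C_of_natDegree_eq_zero h, coeff_iterate_derivative, zero_add,
    ← natDegree_X_sq_sub_one_pow ℓ, (X_sq_sub_one_pow_monic ℓ).coeff_natDegree,
    natDegree_X_sq_sub_one_pow, Nat.descFactorial_self, smul_C, ← two_mul]
  congr 1
  simp only [nsmul_eq_mul, smul_eq_mul]
  ring

open Polynomial in
theorem degree_legendreP (ℓ : ℕ) : (legendreP ℓ).degree = ℓ := by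
  have hle : (legendreP ℓ).natDegree ≤ ℓ := by
    refine (natDegree_smul_le _ _).trans ((natDegree_iterate_derivative _ _).trans ?_)
    rw [natDegree_X_sq_sub_one_pow]
    omega
  have hc : (legendreP ℓ).coeff ℓ ≠ 0 := by
    rw [legendreP, coeff_smul, coeff_iterate_derivative, ← natDegree_X_sq_sub_one_pow ℓ,
      (X_sq_sub_one_pow_monic ℓ).coeff_natDegree, natDegree_X_sq_sub_one_pow]
    have : (ℓ + ℓ).descFactorial ℓ ≠ 0 := by simp [Nat.descFactorial_eq_zero_iff_lt]
    simp only [smul_eq_mul, nsmul_eq_mul, mul_one]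
    positivity
  exact degree_eq_of_le_of_coeff_ne_zero (natDegree_le_iff_degree_le.1 hle) hc

open Polynomial in
theorem integral_eval_mul_legendreP_eq_zero {q : ℝ[X]} {ℓ : ℕ} (h : q.degree < ℓ) :
    ∫ τ in (-1 : ℝ)..1, q.eval τ * (legendreP ℓ).eval τ = 0 := by
  rw [integral_eval_mul_legendreP, iterate_derivative_eq_zero_of_degree_lt h]
  simp

theorem integral_legendreP_mul_legendreP_of_ne {m ℓ : ℕ} (h : m ≠ ℓ) :
    ∫ τ in (-1 : ℝ)..1, (legendreP m).eval τ * (legendreP ℓ).eval τ = 0 := by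
  rcases h.lt_or_gt with h | h
  · exact integral_eval_mul_legendreP_eq_zero (by rw [degree_legendreP]; exact_mod_cast h)
  · simp_rw [mul_comm ((legendreP m).eval _)]
    exact integral_eval_mul_legendreP_eq_zero (by rw [degree_legendreP]; exact_mod_cast h)

theorem integral_one_sub_sq_pow_succ (ℓ : ℕ) :
    (2 * ℓ + 3 : ℝ) * ∫ τ in (-1 : ℝ)..1, (1 - τ ^ 2) ^ (ℓ + 1) =
      (2 * ℓ + 2 : ℝ) * ∫ τ in (-1 : ℝ)..1, (1 - τ ^ 2) ^ ℓ := by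
  have hd : ∀ x : ℝ, HasDerivAt (fun τ : ℝ => τ * (1 - τ ^ 2) ^ (ℓ + 1))
      ((2 * ℓ + 3) * (1 - x ^ 2) ^ (ℓ + 1) - (2 * ℓ + 2) * (1 - x ^ 2) ^ ℓ) x := fun x => by
    convert! (hasDerivAt_id x).mul ((((hasDerivAt_id x).pow 2).const_sub 1).pow (ℓ + 1)) using 1
    simp
    ring
  have h := intervalIntegral.integral_eq_sub_of_hasDerivAt (a := -1) (b := 1)
    (fun x _ => hd x) (Continuous.intervalIntegrable (by fun_prop) _ _)
  rw [intervalIntegral.integral_sub (Continuous.intervalIntegrable (by fun_prop) _ _)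
    (Continuous.intervalIntegrable (by fun_prop) _ _), intervalIntegral.integral_const_mul,
    intervalIntegral.integral_const_mul] at h
  norm_num at h
  linarith

theorem integral_one_sub_sq_pow (ℓ : ℕ) :
    (2 * ℓ + 1 : ℝ) * (2 * ℓ).factorial * ∫ τ in (-1 : ℝ)..1, (1 - τ ^ 2) ^ ℓ =
      2 * (2 ^ ℓ * ℓ.factorial) ^ 2 := by
  induction ℓ with
  | zero => norm_num
  | succ ℓ ih =>
    have h := integral_one_sub_sq_pow_succ ℓ
    rw [show 2 * (ℓ + 1) = 2 * ℓ + 1 + 1 by ring, Nat.factorial_succ, Nat.factorial_succ,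
      Nat.factorial_succ]
    push_cast
    linear_combination ((2 * ℓ + 1 + 1) * (2 * ℓ + 1) * (2 * ℓ).factorial : ℝ) * h +
      (2 * ℓ + 2 : ℝ) ^ 2 * ih

theorem integral_legendreP_sq (ℓ : ℕ) :
    ∫ τ in (-1 : ℝ)..1, (legendreP ℓ).eval τ * (legendreP ℓ).eval τ = 2 / (2 * ℓ + 1) := by
  rw [integral_eval_mul_legendreP, iterate_derivative_legendreP]
  simp only [Polynomial.eval_C]
  rw [intervalIntegral.integral_mul_const]
  have h := integral_one_sub_sq_pow ℓ
  field_simp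
  linear_combination h

open Polynomial in
/-- A polynomial is the sum of its Legendre series. -/
theorem hasSum_legendreP_eval (q : ℝ[X]) (t : ℝ) :
    HasSum (fun ℓ : ℕ => (2 * ℓ + 1) / 2 *
      (∫ τ in (-1 : ℝ)..1, q.eval τ * (legendreP ℓ).eval τ) * (legendreP ℓ).eval t)
      (q.eval t) := by
  let S : Polynomial.Sequence ℝ := ⟨legendreP, degree_legendreP⟩
  have hq : q ∈ Submodule.span ℝ (Set.range S) := by
    rw [S.span fun i => (leadingCoeff_ne_zero.2 (S.ne_zero i)).isUnit]
    trivial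
  induction hq using Submodule.span_induction with
  | mem p hp =>
    obtain ⟨m, rfl⟩ := hp
    change HasSum (fun ℓ : ℕ => (2 * ℓ + 1) / 2 *
      (∫ τ in (-1 : ℝ)..1, (legendreP m).eval τ * (legendreP ℓ).eval τ) * (legendreP ℓ).eval t)
      ((legendreP m).eval t)
    convert hasSum_single m fun ℓ hℓ => ?_ using 1
    · rw [integral_legendreP_sq]
      field_simp
    · simp [integral_legendreP_mul_legendreP_of_ne hℓ.symm]
  | zero => simp
  | add p r _ _ hp hr =>
    convert! hp.add hr using 1
    · ext ℓ
      simp only [eval_add, add_mul]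
      rw [intervalIntegral.integral_add (Continuous.intervalIntegrable (by fun_prop) _ _)
        (Continuous.intervalIntegrable (by fun_prop) _ _)]
      ring
    · simp
  | smul a p _ hp =>
    convert! hp.mul_left a using 1
    · ext ℓ
      simp only [eval_smul, smul_eq_mul, mul_assoc]
      rw [intervalIntegral.integral_const_mul]
      ring
    · simp

open Polynomial in
theorem abs_legendreP_eval_le (ℓ : ℕ) {t : ℝ} (ht : t ∈ Set.Icc (-1 : ℝ) 1) :
    |(legendreP ℓ).eval t| ≤ 4 ^ ℓ := by
  have h₁ : |t - 1| ≤ 2 := abs_le.2 ⟨by linarith [ht.1], by linarith [ht.2]⟩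
  have h₂ : |t + 1| ≤ 2 := abs_le.2 ⟨by linarith [ht.1], by linarith [ht.2]⟩
  have hw : ((X ^ 2 - 1 : ℝ[X]) ^ ℓ) = (X - C 1) ^ ℓ * (X + C 1) ^ ℓ := by
    rw [← mul_pow, C_1]
    ring
  have key : |(derivative^[ℓ] ((X ^ 2 - 1 : ℝ[X]) ^ ℓ)).eval t| ≤
      ∑ k ∈ Finset.range ℓ.succ, (2 ^ ℓ * ℓ.factorial) * (2 ^ ℓ * (ℓ.choose k : ℝ)) := by
    rw [hw, iterate_derivative_mul, eval_finsetSum]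
    refine (Finset.abs_sum_le_sum_abs _ _).trans (Finset.sum_le_sum fun k hk => ?_)
    have hk : k ≤ ℓ := Finset.mem_range_succ_iff.1 hk
    rw [iterate_derivative_X_sub_pow, iterate_derivative_X_add_pow, Nat.sub_sub_self hk]
    simp only [nsmul_eq_mul, eval_mul, eval_natCast, eval_pow, eval_sub, eval_add, eval_X, eval_C,
      abs_mul, abs_pow, Nat.abs_cast]
    have hd : (ℓ.choose k : ℝ) * (ℓ.descFactorial (ℓ - k) * ℓ.descFactorial k) =
        ℓ.factorial * (ℓ.choose k * ℓ.choose k) := by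
      rw [Nat.descFactorial_eq_factorial_mul_choose, Nat.descFactorial_eq_factorial_mul_choose,
        Nat.choose_symm hk, ← Nat.choose_mul_factorial_mul_factorial hk]
      push_cast
      ring
    have hc : (ℓ.choose k : ℝ) ≤ 2 ^ ℓ := by exact_mod_cast Nat.choose_le_two_pow ℓ k
    calc (ℓ.choose k : ℝ) * (ℓ.descFactorial (ℓ - k) * |t - 1| ^ k *
          (ℓ.descFactorial k * |t + 1| ^ (ℓ - k)))
        = ℓ.factorial * (ℓ.choose k * ℓ.choose k) * (|t - 1| ^ k * |t + 1| ^ (ℓ - k)) := by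
          rw [← hd]
          ring
      _ ≤ ℓ.factorial * (2 ^ ℓ * ℓ.choose k) * (2 ^ k * 2 ^ (ℓ - k)) := by gcongr
      _ = (2 ^ ℓ * ℓ.factorial) * (2 ^ ℓ * (ℓ.choose k : ℝ)) := by
          rw [← pow_add, Nat.add_sub_cancel' hk]
          ring
  have hs : (∑ k ∈ Finset.range ℓ.succ, (ℓ.choose k : ℝ)) = 2 ^ ℓ := by
    exact_mod_cast Nat.sum_range_choose ℓ
  rw [← Finset.mul_sum, ← Finset.mul_sum, hs, ← mul_pow] at key
  norm_num at key
  rw [legendreP, eval_smul, smul_eq_mul, abs_mul, abs_of_nonneg (by positivity), one_div,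
    inv_mul_le_iff₀ (by positivity)]
  exact key

theorem abs_integral_pow_mul_legendreP_le (n ℓ : ℕ) :
    |∫ τ in (-1 : ℝ)..1, τ ^ n * (legendreP ℓ).eval τ| ≤ 2 * 4 ^ ℓ := by
  have h := intervalIntegral.norm_integral_le_of_norm_le_const (a := (-1 : ℝ)) (b := 1)
    (f := fun τ => τ ^ n * (legendreP ℓ).eval τ) (C := 4 ^ ℓ) fun τ hτ => by
      rw [Set.uIoc_of_le (by norm_num)] at hτ
      rw [Real.norm_eq_abs, abs_mul, abs_pow]
      have h₁ : |τ| ^ n ≤ 1 := pow_le_one₀ (abs_nonneg _) (abs_le.2 ⟨hτ.1.le, hτ.2⟩)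
      have h₂ := abs_legendreP_eval_le ℓ ⟨hτ.1.le, hτ.2⟩
      nlinarith [abs_nonneg ((legendreP ℓ).eval τ)]
  rw [Real.norm_eq_abs] at h
  norm_num at h
  linarith

theorem abs_legendre_term_le (n ℓ : ℕ) {t : ℝ} (ht : t ∈ Set.Icc (-1 : ℝ) 1) :
    |(2 * ℓ + 1) / 2 * (∫ τ in (-1 : ℝ)..1, τ ^ n * (legendreP ℓ).eval τ) *
      (legendreP ℓ).eval t| ≤ 96 ^ n * (1 / 2) ^ ℓ := by
  rcases lt_or_ge n ℓ with h | h
  · have h0 := integral_eval_mul_legendreP_eq_zero (q := Polynomial.X ^ n) (ℓ := ℓ)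
      (by rw [Polynomial.degree_X_pow]; exact_mod_cast h)
    simp only [Polynomial.eval_pow, Polynomial.eval_X] at h0
    rw [h0, mul_zero, zero_mul, abs_zero]
    positivity
  · have h3 : (2 * ℓ + 1 : ℝ) ≤ 3 ^ ℓ := by
      have := one_add_mul_le_pow (a := (2 : ℝ)) (by norm_num) ℓ
      norm_num at this
      linarith
    rw [abs_mul, abs_mul, abs_of_nonneg (by positivity : (0 : ℝ) ≤ (2 * ℓ + 1) / 2)]
    calc (2 * ℓ + 1 : ℝ) / 2 * |∫ τ in (-1 : ℝ)..1, τ ^ n * (legendreP ℓ).eval τ| *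
          |(legendreP ℓ).eval t|
        ≤ 3 ^ ℓ / 2 * (2 * 4 ^ ℓ) * 4 ^ ℓ := by
          gcongr
          · exact abs_integral_pow_mul_legendreP_le n ℓ
          · exact abs_legendreP_eval_le ℓ ht
      _ = 96 ^ ℓ * (1 / 2) ^ ℓ := by
          rw [show (96 : ℝ) = 3 * 4 * 4 * 2 by norm_num]
          simp only [mul_pow, one_div, inv_pow]
          field_simp
      _ ≤ 96 ^ n * (1 / 2) ^ ℓ := by
          gcongr
          norm_num

theorem hasSum_pow_div_factorial_cexp (z : ℂ) :
    HasSum (fun n : ℕ => z ^ n / n.factorial) (Complex.exp z) := by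
  rw [Complex.exp_eq_exp_ℂ]
  exact NormedSpace.expSeries_div_hasSum_exp z

theorem hasSum_integral_cexp_mul_legendreP (x : ℝ) (ℓ : ℕ) :
    HasSum (fun n : ℕ => (Complex.I * x) ^ n / n.factorial *
        ((∫ τ in (-1 : ℝ)..1, τ ^ n * (legendreP ℓ).eval τ : ℝ) : ℂ))
      (∫ τ in (-1 : ℝ)..1,
        Complex.exp (Complex.I * x * τ) * (((legendreP ℓ).eval τ : ℝ) : ℂ)) := by
  have h := intervalIntegral.hasSum_integral_of_dominated_convergence (a := -1) (b := 1)
    (μ := MeasureTheory.volume)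
    (F := fun (n : ℕ) (τ : ℝ) => (Complex.I * x) ^ n / n.factorial *
      ((τ ^ n * (legendreP ℓ).eval τ : ℝ) : ℂ))
    (f := fun τ : ℝ => Complex.exp (Complex.I * x * τ) * (((legendreP ℓ).eval τ : ℝ) : ℂ))
    (fun n _ => |x| ^ n / n.factorial * 4 ^ ℓ)
    (fun n => Continuous.aestronglyMeasurable (by fun_prop)) ?_ ?_ ?_ ?_
  · simpa only [intervalIntegral.integral_const_mul, intervalIntegral.integral_ofReal] using h
  · refine fun n => .of_forall fun τ hτ => ?_
    rw [Set.uIoc_of_le (by norm_num)] at hτ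
    have h₁ : |τ| ^ n ≤ 1 := pow_le_one₀ (abs_nonneg _) (abs_le.2 ⟨hτ.1.le, hτ.2⟩)
    have h₂ := abs_legendreP_eval_le ℓ ⟨hτ.1.le, hτ.2⟩
    rw [norm_mul, norm_div, norm_pow, norm_mul, Complex.norm_I, one_mul, Complex.norm_real,
      Complex.norm_real, Complex.norm_natCast, Real.norm_eq_abs, Real.norm_eq_abs, abs_mul, abs_pow]
    gcongr
    nlinarith [abs_nonneg ((legendreP ℓ).eval τ)]
  · exact .of_forall fun τ _ => (Real.summable_pow_div_factorial |x|).mul_right _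
  · exact intervalIntegrable_const
  · refine .of_forall fun τ _ => ?_
    convert! (hasSum_pow_div_factorial_cexp (Complex.I * x * τ)).mul_right
      (((legendreP ℓ).eval τ : ℝ) : ℂ) using 2 with n
    push_cast
    ring

/-- Legendre-series (plane-wave) expansion. -/
theorem stmt14 (x t : ℝ) (ht : t ∈ Set.Icc (-1 : ℝ) 1) :
    HasSum (fun ℓ : ℕ =>
        ((2 * ℓ + 1 : ℝ) / 2 : ℂ) *
          (∫ τ in (-1:ℝ)..1, Complex.exp (Complex.I * x * τ) * (((legendreP ℓ).eval τ : ℝ) : ℂ)) *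
          (((legendreP ℓ).eval t : ℝ) : ℂ))
      (Complex.exp (Complex.I * x * t)) := by
  let F : ℕ × ℕ → ℂ := fun p => (Complex.I * x) ^ p.1 / p.1.factorial *
    (((2 * p.2 + 1) / 2 * (∫ τ in (-1 : ℝ)..1, τ ^ p.1 * (legendreP p.2).eval τ) *
      (legendreP p.2).eval t : ℝ) : ℂ)
  have hF : Summable F := by
    refine Summable.of_norm_bounded (g := fun p : ℕ × ℕ =>
      (96 * |x|) ^ p.1 / p.1.factorial * (1 / 2 : ℝ) ^ p.2)
      ((Real.summable_pow_div_factorial (96 * |x|)).mul_of_nonneg summable_geometric_two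
        (fun n => by positivity) (fun n => by positivity)) fun p => ?_
    rw [norm_mul, norm_div, norm_pow, norm_mul, Complex.norm_I, one_mul, Complex.norm_real,
      Complex.norm_real, Complex.norm_natCast, Real.norm_eq_abs, Real.norm_eq_abs]
    calc _ ≤ |x| ^ p.1 / p.1.factorial * (96 ^ p.1 * (1 / 2) ^ p.2) := by
          gcongr
          exact abs_legendre_term_le p.1 p.2 ht
      _ = _ := by
          rw [mul_pow]
          ring
  have hrow : ∀ n, HasSum (fun ℓ => F (n, ℓ)) ((Complex.I * x * t) ^ n / n.factorial) := fun n => by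
    have h := hasSum_legendreP_eval (Polynomial.X ^ n) t
    simp only [Polynomial.eval_pow, Polynomial.eval_X] at h
    convert! (Complex.hasSum_ofReal.2 h).mul_left ((Complex.I * x) ^ n / n.factorial) using 1
    push_cast
    ring
  have hsum : HasSum F (Complex.exp (Complex.I * x * t)) := by
    rw [(hasSum_pow_div_factorial_cexp _).unique (hF.hasSum.prod_fiberwise hrow)]
    exact hF.hasSum
  refine HasSum.prod_fiberwise ((Equiv.prodComm ℕ ℕ).hasSum_iff.2 hsum) fun ℓ => ?_
  convert! ((hasSum_integral_cexp_mul_legendreP x ℓ).mul_left ((2 * ℓ + 1 : ℝ) / 2 : ℂ)).mul_right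
    (((legendreP ℓ).eval t : ℝ) : ℂ) using 2 with n
  simp only [F, Function.comp_apply, Equiv.prodComm_apply, Prod.swap_prod_mk]
  push_cast
  ring
end
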